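/- Let ψ ∈ M_C (so that in particular ψ ∈ F), β ∈ ℝ, and φ(k) = k/ψ(k). Then there exists a constant C = C(ψ) > 0 such that for all n ∈ ℕ and all β ∈ ℝ, E(C^ψ_{β,∞}; Z^φ_n) ≤ C·ψ(n). -/

import Mathlib

open MeasureTheory Real Filter Set

noncomputable section

/-- The `k`-th Fourier cosine coefficient of a `2π`-periodic function. -/
def fourierA (f : ℝ → ℝ) (k : ℕ) : ℝ := (1 / π) * ∫ t in (-π)..π, f t * Real.cos (k * t)

/-- The `k`-th Fourier sine coefficient of a `2π`-periodic function. -/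
def fourierB (f : ℝ → ℝ) (k : ℕ) : ℝ := (1 / π) * ∫ t in (-π)..π, f t * Real.sin (k * t)

/-- The harmonicTerm `A_k(f;x)`. -/
def harmonicTerm (f : ℝ → ℝ) (k : ℕ) (x : ℝ) : ℝ :=
  if k = 0 then fourierA f 0 / 2
  else fourierA f k * Real.cos (k * x) + fourierB f k * Real.sin (k * x)

/-- `2π`-periodicity. -/
def Periodic2pi (f : ℝ → ℝ) : Prop := ∀ x, f (x + 2 * π) = f x

/-- The set `S_∞`: measurable `2π`-periodic functions essentially bounded by 1. -/
def SInf (φ : ℝ → ℝ) : Prop :=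
  Measurable φ ∧ Periodic2pi φ ∧ (∀ᵐ t ∂(volume : Measure ℝ), |φ t| ≤ 1)

/-- `φ` is the `(ψ,β)`-derivative of `f`: `φ ∈ S_∞` and the series
`Σ (1/ψ k)(a_k(f) cos(kx+βπ/2) + b_k(f) sin(kx+βπ/2))` is the Fourier series of `φ`. -/
def IsPsiDeriv (ψ : ℕ → ℝ) (β : ℝ) (f φ : ℝ → ℝ) : Prop :=
  SInf φ ∧ fourierA φ 0 = 0 ∧
    ∀ k : ℕ, 1 ≤ k →
      fourierA φ k = (1 / ψ k) *
        (fourierA f k * Real.cos (β * π / 2) + fourierB f k * Real.sin (β * π / 2)) ∧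
      fourierB φ k = (1 / ψ k) *
        (fourierB f k * Real.cos (β * π / 2) - fourierA f k * Real.sin (β * π / 2))

/-- The class `C^ψ_{β,∞}`. -/
def ClassC (ψ : ℕ → ℝ) (β : ℝ) (f : ℝ → ℝ) : Prop :=
  Continuous f ∧ Periodic2pi f ∧ ∃ φ, IsPsiDeriv ψ β f φ

/-- Multipliers of the sums `U^ψ_{n,p}` (with `φ(k) = (k-n+p)/ψ(k)`). -/
def lambdaU (ψ : ℕ → ℝ) (n p k : ℕ) : ℝ :=
  if k ≤ n - p then 1
  else 1 - (((k : ℝ) - n + p) / ψ k) / ((p : ℝ) / ψ n)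

/-- The sums `U^ψ_{n,p}(f;x)`. -/
def Usum (ψ : ℕ → ℝ) (n p : ℕ) (f : ℝ → ℝ) (x : ℝ) : ℝ :=
  ∑ k ∈ Finset.range n, lambdaU ψ n p k * harmonicTerm f k x

/-- `E(C^ψ_{β,∞}; T) = sup_{f ∈ C^ψ_{β,∞}} ‖f - T f‖_C`. -/
def classSup (ψ : ℕ → ℝ) (β : ℝ) (T : (ℝ → ℝ) → ℝ → ℝ) : ℝ :=
  sSup {e | ∃ f, ClassC ψ β f ∧ e = ⨆ x : ℝ, |f x - T f x|}

/-- The characteristic `η(ψ;t) = ψ⁻¹(ψ(t)/2)` (inverse taken on `[1,∞)`). -/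
def eta (ψ : ℝ → ℝ) (t : ℝ) : ℝ := Function.invFunOn ψ (Set.Ici 1) (ψ t / 2)

/-- The set `M`: positive convex functions on `[1,∞)` vanishing at infinity. -/
def MClass (ψ : ℝ → ℝ) : Prop :=
  (∀ t ≥ (1 : ℝ), 0 < ψ t) ∧ ConvexOn ℝ (Set.Ici 1) ψ ∧ Tendsto ψ atTop (nhds 0)

/-- The set `F = {ψ ∈ M : η'(ψ;t) ≤ K for all t ≥ 1}`. -/
def FClass (ψ : ℝ → ℝ) : Prop :=
  MClass ψ ∧ ∃ K : ℝ, ∀ t ≥ (1 : ℝ), DifferentiableAt ℝ (eta ψ) t ∧ deriv (eta ψ) t ≤ K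

/-- The generalized Zygmund sum `Z^φ_n(f;x) = Σ_{k=0}^{n-1} (1 - φ(k)/φ(n)) A_k(f;x)`. -/
def ZygmundSum (φ : ℕ → ℝ) (n : ℕ) (f : ℝ → ℝ) (x : ℝ) : ℝ :=
  ∑ k ∈ Finset.range n, (1 - φ k / φ n) * harmonicTerm f k x

/-- The set `M_C = {ψ ∈ M : 0 < C₁ ≤ t/T(ψ;t) ≤ C₂ for all t ≥ 1}`,
where `T(ψ;t) = η(ψ;t) - t`. -/
def MCClass (ψ : ℝ → ℝ) : Prop :=
  MClass ψ ∧ ∃ C₁ C₂ : ℝ, 0 < C₁ ∧ C₁ ≤ C₂ ∧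
    ∀ t ≥ (1 : ℝ), C₁ ≤ t / (eta ψ t - t) ∧ t / (eta ψ t - t) ≤ C₂

/-! ### Fejér means -/

/-- The Fejér kernel, normalised to have integral `π` over a period. -/
def fejerKernel (N : ℕ) (s : ℝ) : ℝ :=
  ∑ k ∈ Finset.range N, (1 - (k : ℝ) / N) * (Real.cos (k * s) - if k = 0 then 1 / 2 else 0)

lemma one_sub_cos_mul_dirichlet (N : ℕ) (s : ℝ) :
    (1 - Real.cos s) *
        ∑ k ∈ Finset.range (N + 1), (Real.cos (k * s) - if k = 0 then 1 / 2 else 0) =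
      (Real.cos (N * s) - Real.cos ((N + 1 : ℕ) * s)) / 2 := by
  induction N with
  | zero => simp; ring
  | succ N ih =>
    rw [Finset.sum_range_succ, mul_add, ih]
    have h1 : ((N + 1 + 1 : ℕ) : ℝ) * s = (N + 1 : ℕ) * s + s := by push_cast; ring
    have h2 : (N : ℝ) * s = (N + 1 : ℕ) * s - s := by push_cast; ring
    rw [h1, h2, Real.cos_add, Real.cos_sub]
    simp only [Nat.add_eq_zero_iff, one_ne_zero, and_false, if_false]
    ring

lemma one_sub_cos_mul_fejerKernel (N : ℕ) (s : ℝ) :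
    (1 - Real.cos s) * (N * fejerKernel N s) = (1 - Real.cos (N * s)) / 2 := by
  have key : ∀ M : ℕ, (1 - Real.cos s) * ∑ k ∈ Finset.range M,
      ((M : ℝ) - k) * (Real.cos (k * s) - if k = 0 then 1 / 2 else 0) =
        (1 - Real.cos (M * s)) / 2 := by
    intro M
    induction M with
    | zero => simp
    | succ M ih =>
      have : ∑ k ∈ Finset.range (M + 1), (((M + 1 : ℕ) : ℝ) - k) *
            (Real.cos (k * s) - if k = 0 then 1 / 2 else 0) =
          ∑ k ∈ Finset.range M, ((M : ℝ) - k) * (Real.cos (k * s) - if k = 0 then 1 / 2 else 0) +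
          ∑ k ∈ Finset.range (M + 1), (Real.cos (k * s) - if k = 0 then 1 / 2 else 0) := by
        rw [Finset.sum_range_succ, Finset.sum_range_succ (n := M) (f := fun k : ℕ =>
          (Real.cos (k * s) - if k = 0 then 1 / 2 else 0)), ← add_assoc, ← Finset.sum_add_distrib]
        congr 1
        · refine Finset.sum_congr rfl fun k _ => ?_
          push_cast; ring
        · push_cast; ring
      rw [this, mul_add, ih, one_sub_cos_mul_dirichlet]
      ring
  rw [← key N, fejerKernel, Finset.mul_sum]
  congr 1
  refine Finset.sum_congr rfl fun k hk => ?_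
  have : (N : ℝ) ≠ 0 := by
    have := Finset.mem_range.1 hk
    exact_mod_cast (by omega : N ≠ 0)
  field_simp

lemma continuous_fejerKernel (N : ℕ) : Continuous (fejerKernel N) := by
  unfold fejerKernel
  fun_prop

lemma fejerKernel_nonneg (N : ℕ) (s : ℝ) : 0 ≤ fejerKernel N s := by
  rcases (Real.cos_le_one s).lt_or_eq with h | h
  · rcases Nat.eq_zero_or_pos N with rfl | hN
    · simp [fejerKernel]
    have hN' : (0 : ℝ) < N := by exact_mod_cast hN
    have h1 := one_sub_cos_mul_fejerKernel N s
    have h2 := Real.cos_le_one (N * s)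
    by_contra! hneg
    have : (1 - Real.cos s) * (N * fejerKernel N s) < 0 :=
      mul_neg_of_pos_of_neg (by linarith) (mul_neg_of_pos_of_neg hN' hneg)
    linarith
  · obtain ⟨m, rfl⟩ := (Real.cos_eq_one_iff s).1 h
    refine Finset.sum_nonneg fun k hk => ?_
    have h1 : (k : ℝ) ≤ N := by exact_mod_cast (Finset.mem_range.1 hk).le
    have h2 : (k : ℝ) / N ≤ 1 := div_le_one_of_le₀ h1 (by positivity)
    have h3 : Real.cos (k * (m * (2 * π))) = 1 := by
      rw [Real.cos_eq_one_iff]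
      exact ⟨k * m, by push_cast; ring⟩
    rw [h3]
    refine mul_nonneg (by linarith) ?_
    split_ifs <;> norm_num

lemma integral_fejerKernel {N : ℕ} (hN : 1 ≤ N) :
    ∫ s in (-π)..π, fejerKernel N s = π := by
  obtain ⟨M, rfl⟩ : ∃ M, N = M + 1 := ⟨N - 1, by omega⟩
  unfold fejerKernel
  rw [intervalIntegral.integral_finsetSum
    (fun k _ => Continuous.intervalIntegrable (by fun_prop) _ _), Finset.sum_range_succ']
  have : ∀ k ∈ Finset.range M, ∫ s in (-π)..π, (1 - ((k + 1 : ℕ) : ℝ) / (M + 1 : ℕ)) *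
      (Real.cos ((k + 1 : ℕ) * s) - if k + 1 = 0 then 1 / 2 else 0) = 0 := by
    intro k _
    have hk : ((k + 1 : ℕ) : ℝ) ≠ 0 := by positivity
    rw [intervalIntegral.integral_const_mul]
    simp only [Nat.add_eq_zero_iff, one_ne_zero, and_false, if_false, sub_zero]
    rw [intervalIntegral.integral_comp_mul_left _ hk, integral_cos]
    simp
    right; right
    exact_mod_cast Real.sin_nat_mul_pi (k + 1)
  rw [Finset.sum_eq_zero this]
  simp
  ring

lemma one_sub_cos_ge {s : ℝ} (hs : |s| ≤ π) : 2 * (s / π) ^ 2 ≤ 1 - Real.cos s := by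
  have := Real.cos_le_one_sub_mul_cos_sq hs
  have hp := Real.pi_pos
  rw [div_pow]
  have e : 2 * (s ^ 2 / π ^ 2) = 2 / π ^ 2 * s ^ 2 := by ring
  linarith

/-- The `k`-th harmonic as a convolution. -/
lemma harmonicTerm_eq_integral {f : ℝ → ℝ} (hf : IntervalIntegrable f volume (-π) π)
    (k : ℕ) (x : ℝ) :
    harmonicTerm f k x =
      (1 / π) * ∫ t in (-π)..π, f t * (Real.cos (k * (x - t)) - if k = 0 then 1 / 2 else 0) := by
  unfold harmonicTerm
  split_ifs with h
  · subst h
    simp only [fourierA, Nat.cast_zero, zero_mul, Real.cos_zero, mul_one]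
    rw [intervalIntegral.integral_mul_const]
    ring
  · have e : ∀ t, f t * (Real.cos (k * (x - t)) - 0) =
        f t * Real.cos (k * t) * Real.cos (k * x) + f t * Real.sin (k * t) * Real.sin (k * x) := by
      intro t
      rw [sub_zero, mul_sub (k : ℝ), Real.cos_sub]; ring
    simp only [e]
    rw [intervalIntegral.integral_add, intervalIntegral.integral_mul_const,
      intervalIntegral.integral_mul_const, fourierA, fourierB]
    · ring
    · exact (hf.mul_continuousOn (by fun_prop)).mul_continuousOn (by fun_prop)
    · exact (hf.mul_continuousOn (by fun_prop)).mul_continuousOn (by fun_prop)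

lemma fejerMean_eq_integral {f : ℝ → ℝ} (hf : Continuous f) (hp : Periodic2pi f)
    (N : ℕ) (x : ℝ) :
    ∑ k ∈ Finset.range N, (1 - (k : ℝ) / N) * harmonicTerm f k x =
      ∫ s in Ioc (-π) π, (fejerKernel N s / π) • f (x - s) := by
  have h1 : ∑ k ∈ Finset.range N, (1 - (k : ℝ) / N) * harmonicTerm f k x =
      ∫ t in (-π)..π, (fejerKernel N (x - t) / π) * f t := by
    simp only [harmonicTerm_eq_integral (hf.intervalIntegrable _ _), fejerKernel,
      Finset.sum_div, Finset.sum_mul]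
    rw [intervalIntegral.integral_finsetSum
      (fun k _ => Continuous.intervalIntegrable (by fun_prop) _ _)]
    refine Finset.sum_congr rfl fun k _ => ?_
    rw [← intervalIntegral.integral_const_mul, ← intervalIntegral.integral_const_mul]
    refine intervalIntegral.integral_congr fun t _ => ?_
    ring
  have hper : Function.Periodic (fun s => (fejerKernel N s / π) * f (x - s)) (2 * π) := by
    intro s
    have e1 : f (x - (s + 2 * π)) = f (x - s) := by
      rw [← hp (x - (s + 2 * π))]; congr 1; ring
    have e2 : fejerKernel N (s + 2 * π) = fejerKernel N s := by
      unfold fejerKernel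
      refine Finset.sum_congr rfl fun k _ => ?_
      rw [mul_add, Real.cos_add_nat_mul_two_pi]
    simp only [e1, e2]
  have h2 := intervalIntegral.integral_comp_sub_left
    (fun s => (fejerKernel N s / π) * f (x - s)) x (a := -π) (b := π)
  have h3 := hper.intervalIntegral_add_eq (x - π) (-π)
  rw [h1, ← intervalIntegral.integral_of_le (by linarith [Real.pi_pos])]
  simp only [smul_eq_mul]
  simp only [sub_sub_cancel] at h2
  rw [h2]
  convert h3 using 2 <;> ring

/-- Fejér's theorem at a point. -/
lemma tendsto_fejerMean {f : ℝ → ℝ} (hf : Continuous f) (hp : Periodic2pi f) (x : ℝ) :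
    Tendsto (fun N : ℕ => ∑ k ∈ Finset.range N, (1 - (k : ℝ) / N) * harmonicTerm f k x)
      atTop (nhds (f x)) := by
  have hpi := Real.pi_pos
  simp only [fejerMean_eq_integral hf hp]
  refine tendsto_setIntegral_peak_smul_of_integrableOn_of_tendsto (x₀ := 0)
    (t := Ioc (-π) π) measurableSet_Ioc measurableSet_Ioc le_rfl self_mem_nhdsWithin ?_
    ?_ ?_ ?_ ?_ ?_ ?_
  · simp
  · exact Eventually.of_forall fun N s _ => div_nonneg (fejerKernel_nonneg N s) hpi.le
  · intro u hu h0
    obtain ⟨δ, hδ, hball⟩ := Metric.isOpen_iff.1 hu 0 h0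
    rw [Metric.tendstoUniformlyOn_iff]
    intro ε hε
    have hδ' : 0 < (δ / π) ^ 2 := by positivity
    have hlim : Tendsto (fun N : ℕ => (1 / (2 * (δ / π) ^ 2 * π)) * (1 / (N : ℝ)))
        atTop (nhds 0) := by
      have := (tendsto_one_div_atTop_nhds_zero_nat (𝕜 := ℝ)).const_mul
        (1 / (2 * (δ / π) ^ 2 * π))
      rwa [mul_zero] at this
    filter_upwards [hlim.eventually (gt_mem_nhds hε), eventually_gt_atTop 0] with N hN hN0 s hs
    have hN0' : (0 : ℝ) < N := by exact_mod_cast hN0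
    have hs1 : |s| ≤ π := abs_le.2 ⟨hs.1.1.le, hs.1.2⟩
    have hs2 : δ ≤ |s| := by
      by_contra! hlt
      exact hs.2 (hball (by simpa using hlt))
    have hc := one_sub_cos_ge hs1
    have hc' : 2 * (δ / π) ^ 2 ≤ 1 - Real.cos s := by
      refine le_trans ?_ hc
      have : (δ / π) ^ 2 ≤ (s / π) ^ 2 := by
        rw [div_pow, div_pow, ← sq_abs s]
        gcongr
      linarith
    have hF := one_sub_cos_mul_fejerKernel N s
    have hn := fejerKernel_nonneg N s
    have hF1 : 2 * (δ / π) ^ 2 * (N * fejerKernel N s) ≤ 1 := by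
      have : 2 * (δ / π) ^ 2 * (N * fejerKernel N s) ≤
          (1 - Real.cos s) * (N * fejerKernel N s) := by gcongr
      linarith [Real.neg_one_le_cos (N * s)]
    have : fejerKernel N s / π ≤ (1 / (2 * (δ / π) ^ 2 * π)) * (1 / (N : ℝ)) := by
      rw [← one_div_mul_one_div_rev, mul_assoc, div_eq_mul_one_div, mul_comm]
      refine mul_le_mul_of_nonneg_left ?_ (by positivity)
      rw [one_div_mul_one_div, le_div_iff₀ (by positivity)]
      linarith
    simp only [Pi.zero_apply, dist_zero_left, Real.norm_eq_abs]
    rw [abs_of_nonneg (div_nonneg hn hpi.le)]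
    exact this.trans_lt hN
  · refine tendsto_const_nhds.congr' ?_
    filter_upwards [eventually_ge_atTop 1] with N hN
    rw [← intervalIntegral.integral_of_le (by linarith), intervalIntegral.integral_div,
      integral_fejerKernel hN, div_self hpi.ne']
  · exact Eventually.of_forall fun N =>
      ((continuous_fejerKernel N).div_const π).aestronglyMeasurable
  · exact (Continuous.integrableOn_Icc (by fun_prop)).mono_set Ioc_subset_Icc_self
  · have : Continuous fun s => f (x - s) := by fun_prop
    have h := (this.tendsto 0).mono_left (nhdsWithin_le_nhds (s := Ioc (-π) π))
    simpa using h

/-! ### Functions of class `M_C` -/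

lemma MClass.le_of_le {ψ : ℝ → ℝ} (h : MClass ψ) {x y : ℝ} (hx : 1 ≤ x) (hxy : x ≤ y) :
    ψ y ≤ ψ x := by
  obtain ⟨hpos, hconv, hlim⟩ := h
  by_contra! hlt
  have hxy' : x < y := lt_of_le_of_ne hxy (by rintro rfl; exact lt_irrefl _ hlt)
  have hy := hpos y (hx.trans hxy)
  obtain ⟨z, hz1, hz2⟩ := ((hlim.eventually (gt_mem_nhds hy)).and (eventually_gt_atTop y)).exists
  have := hconv.le_right_of_left_le'' (mem_Ici.2 hx) (mem_Ici.2 (by linarith)) hxy' hz2.le hlt.le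
  linarith

lemma MClass.apply_eta {ψ : ℝ → ℝ} (h : MClass ψ) {t : ℝ} (ht : 2 ≤ t) :
    ψ (eta ψ t) = ψ t / 2 := by
  obtain ⟨hpos, hconv, hlim⟩ := h
  have hcont : ContinuousOn ψ (Ioi 1) := by
    have := hconv.continuousOn_interior
    rwa [interior_Ici] at this
  have hψt := hpos t (by linarith)
  obtain ⟨z, hz1, hz2⟩ :=
    ((hlim.eventually (gt_mem_nhds (half_pos hψt))).and (eventually_gt_atTop t)).exists
  obtain ⟨y, hy, hy'⟩ := intermediate_value_Icc' hz2.le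
    (hcont.mono fun u hu => lt_of_lt_of_le (by linarith) hu.1) ⟨hz1.le, by linarith⟩
  exact Function.invFunOn_eq ⟨y, mem_Ici.2 (by linarith [hy.1]), hy'⟩

/-- A function of class `M_C` decreases by a factor comparable to `2` on geometric scales. -/
lemma MCClass.exists_scales {ψ : ℝ → ℝ} (h : MCClass ψ) :
    ∃ r > (0 : ℝ), ∃ L ≥ (1 : ℝ), ∀ t ≥ (2 : ℝ),
      ψ t / 2 ≤ ψ ((1 + r) * t) ∧ ψ ((1 + L) * t) ≤ ψ t / 2 := by
  obtain ⟨hM, C₁, C₂, hC₁, hC, hη⟩ := h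
  have hC₂ : 0 < C₂ := hC₁.trans_le hC
  refine ⟨1 / C₂, by positivity, max (1 / C₁) 1, le_max_right _ _, fun t ht => ?_⟩
  have hval := hM.apply_eta ht
  obtain ⟨h1, h2⟩ := hη t (by linarith)
  have hpos : 0 < eta ψ t - t := by
    by_contra! hneg
    have := div_nonpos_of_nonneg_of_nonpos (by linarith : (0 : ℝ) ≤ t) hneg
    linarith
  rw [le_div_iff₀ hpos] at h1
  rw [div_le_iff₀ hpos] at h2
  have ht0 : 0 < t := by linarith
  rw [← hval]
  constructor
  · refine hM.le_of_le ?_ ?_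
    · have : 0 < 1 / C₂ * t := by positivity
      linarith
    · have : 1 / C₂ * t ≤ eta ψ t - t := by
        rw [one_div_mul_eq_div, div_le_iff₀ hC₂]; linarith
      linarith
  · refine hM.le_of_le (by linarith) ?_
    have : eta ψ t - t ≤ 1 / C₁ * t := by
      rw [one_div_mul_eq_div, le_div_iff₀ hC₁]; linarith
    have := mul_le_mul_of_nonneg_right (le_max_left (1 / C₁) 1) ht0.le
    linarith

lemma MCClass.exists_mul_sub_le {ψ : ℝ → ℝ} (h : MCClass ψ) :
    ∃ A > (0 : ℝ), ∀ x ≥ (1 : ℝ), x * (ψ x - ψ (x + 1)) ≤ A * ψ x := by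
  obtain ⟨r, hr, L, -, hs⟩ := h.exists_scales
  refine ⟨2 * (1 + r) + (1 + r) / r, by positivity, fun x hx => ?_⟩
  have hψ := h.1.1 x hx
  have hψ1 := h.1.1 (x + 1) (by linarith)
  have hq : 0 < (1 + r) / r := by positivity
  rcases lt_or_ge x (2 * (1 + r)) with hlt | hge
  · nlinarith
  · set s := x / (1 + r) with hs_def
    have hxs : (1 + r) * s = x := by rw [hs_def]; field_simp
    have hs2 : 2 ≤ s := by rw [hs_def, le_div_iff₀ (by positivity)]; exact hge
    have h1 := (hs s hs2).1
    rw [hxs] at h1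
    have hsx : s < x := by nlinarith
    have h2 := h.1.2.1.secant_mono_aux1 (mem_Ici.2 (by linarith : (1 : ℝ) ≤ s))
      (mem_Ici.2 (by linarith : (1 : ℝ) ≤ x + 1)) hsx (by linarith)
    have h3 : (x - s) * (ψ x - ψ (x + 1)) ≤ ψ x := by linarith
    have h4 : x = (1 + r) / r * (x - s) := by
      rw [← hxs]; field_simp; ring
    calc x * (ψ x - ψ (x + 1)) = (1 + r) / r * ((x - s) * (ψ x - ψ (x + 1))) := by
          rw [← mul_assoc, ← h4]
      _ ≤ (1 + r) / r * ψ x := by gcongr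
      _ ≤ _ := by nlinarith

lemma sum_Ico_sub_succ (u : ℕ → ℝ) {n N : ℕ} (h : n ≤ N) :
    ∑ k ∈ Finset.Ico n N, (u k - u (k + 1)) = u n - u N := by
  induction N, h using Nat.le_induction with
  | base => simp
  | succ N h ih => rw [Finset.sum_Ico_succ_top h, ih]; ring

lemma MCClass.exists_sum_div_le {ψ : ℝ → ℝ} (h : MCClass ψ) :
    ∃ B > (0 : ℝ), ∀ n N : ℕ, 1 ≤ n → ∑ k ∈ Finset.Ico n N, ψ k / k ≤ B * ψ n := by
  obtain ⟨r, -, L, hL, hs⟩ := h.exists_scales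
  have hpos : ∀ k : ℕ, 1 ≤ k → 0 < ψ k := fun k hk => h.1.1 k (by exact_mod_cast hk)
  have hstep : ∀ k : ℕ, 2 ≤ k → ψ k / k ≤ 2 * L * (ψ k - ψ (k + 1 : ℕ)) := by
    intro k hk
    have hk' : (2 : ℝ) ≤ k := by exact_mod_cast hk
    have h1 := (hs k hk').2
    have h2 := h.1.2.1.secant_mono_aux1 (x := (k : ℝ)) (y := k + 1) (z := (1 + L) * k)
      (mem_Ici.2 (by linarith)) (mem_Ici.2 (by nlinarith)) (by linarith) (by nlinarith)
    rw [div_le_iff₀ (by linarith)]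
    push_cast
    nlinarith
  have hbig : ∀ n N : ℕ, 2 ≤ n → ∑ k ∈ Finset.Ico n N, ψ k / k ≤ 2 * L * ψ n := by
    intro n N hn
    have hLn : 0 < 2 * L * ψ n := mul_pos (by linarith) (hpos n (by omega))
    rcases le_or_gt N n with hle | hlt
    · rw [Finset.Ico_eq_empty_of_le hle]; simpa using hLn.le
    · have hN := hpos N (by omega)
      calc ∑ k ∈ Finset.Ico n N, ψ k / k
          ≤ ∑ k ∈ Finset.Ico n N, 2 * L * (ψ k - ψ (k + 1 : ℕ)) :=
            Finset.sum_le_sum fun k hk => hstep k (hn.trans (Finset.mem_Ico.1 hk).1)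
        _ = 2 * L * (ψ n - ψ N) := by
            rw [← Finset.mul_sum, sum_Ico_sub_succ (fun k : ℕ => ψ k) hlt.le]
        _ ≤ 2 * L * ψ n := by nlinarith
  refine ⟨1 + 2 * L, by linarith, fun n N hn => ?_⟩
  have hn' := hpos n hn
  rcases hn.lt_or_eq with h2 | rfl
  · linarith [hbig n N h2]
  · rcases Nat.lt_or_ge 1 N with hN | hN
    · rw [Finset.sum_eq_sum_Ico_succ_bot hN]
      have h1 : ∑ k ∈ Finset.Ico (1 + 1) N, ψ k / k ≤ _ := hbig 2 N le_rfl
      have h2 := h.1.le_of_le (x := (1 : ℕ)) (y := (2 : ℕ)) (by simp) (by norm_num)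
      have h3 : 2 * L * ψ (2 : ℕ) ≤ 2 * L * ψ (1 : ℕ) := by gcongr
      have h4 := h1.trans h3
      simp only [Nat.cast_one, div_one] at h4 ⊢
      linarith
    · rw [Finset.Ico_eq_empty_of_le hN, Finset.sum_empty]
      exact mul_nonneg (by linarith) hn'.le

/-! ### An `L¹` estimate for one-sided trigonometric polynomials -/

lemma two_mul_div_pi_le_norm {t : ℝ} (h0 : 0 ≤ t) (h1 : t ≤ π) :
    2 * t / π ≤ ‖Complex.exp (Complex.I * t) - 1‖ := by
  rw [Complex.norm_exp_I_mul_ofReal_sub_one]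
  have := Real.mul_le_sin (x := t / 2) (by linarith) (by linarith)
  refine le_trans ?_ (le_abs_self _)
  have e : 2 * t / π = 2 * (2 / π * (t / 2)) := by ring
  linarith

lemma norm_exp_pow (t : ℝ) (k : ℕ) : ‖Complex.exp (Complex.I * t) ^ k‖ = 1 := by
  rw [norm_pow, mul_comm, Complex.norm_exp_ofReal_mul_I, one_pow]

lemma sum_second_difference (c : ℕ → ℂ) (z : ℂ) (N : ℕ) :
    ∑ k ∈ Finset.range N, (c (k + 2) - 2 * c (k + 1) + c k) * z ^ (k + 2) +
        (c 0 * (1 - 2 * z) + c 1 * z) =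
      (z - 1) ^ 2 * ∑ k ∈ Finset.range N, c k * z ^ k +
        (c N * z ^ N * (1 - 2 * z) + c (N + 1) * z ^ (N + 1)) := by
  induction N with
  | zero => simp
  | succ N ih =>
    rw [Finset.sum_range_succ, Finset.sum_range_succ]
    linear_combination ih

lemma sum_Ico_by_parts' {R : Type*} [CommRing R] (c u : ℕ → R) {n N : ℕ} (h : n ≤ N) :
    ∑ k ∈ Finset.Ico n N, (c k - c (k + 1)) * u (k + 1) + c N * u N =
      c n * u n + ∑ k ∈ Finset.Ico n N, c k * (u (k + 1) - u k) := by
  induction N, h using Nat.le_induction with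
  | base => simp
  | succ N h ih =>
    rw [Finset.sum_Ico_succ_top h, Finset.sum_Ico_succ_top h]
    linear_combination ih

lemma norm_sum_le_of_second_difference {c : ℕ → ℝ} {N : ℕ} (h0 : c 0 = 0) (hN : c N = 0)
    (hN1 : c (N + 1) = 0) {t : ℝ} (ht : 0 < t) (ht' : t ≤ π) :
    ‖∑ k ∈ Finset.range N, (c k : ℂ) * Complex.exp (Complex.I * t) ^ k‖ ≤
      π ^ 2 / 4 * (|c 1| + ∑ k ∈ Finset.range N, |c (k + 2) - 2 * c (k + 1) + c k|) *
        (t ^ 2)⁻¹ := by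
  have hpi := Real.pi_pos
  set z := Complex.exp (Complex.I * t) with hz
  have hid := sum_second_difference (fun k => (c k : ℂ)) z N
  simp only [h0, hN, hN1, Complex.ofReal_zero, zero_mul, add_zero, zero_add] at hid
  have hnorm : ‖z - 1‖ ^ 2 * ‖∑ k ∈ Finset.range N, (c k : ℂ) * z ^ k‖ ≤
      |c 1| + ∑ k ∈ Finset.range N, |c (k + 2) - 2 * c (k + 1) + c k| := by
    rw [← norm_pow, ← norm_mul, ← hid, add_comm]
    refine (norm_add_le _ _).trans (add_le_add ?_ ((norm_sum_le _ _).trans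
      (Finset.sum_le_sum fun k _ => ?_)))
    · have := norm_exp_pow t 1
      rw [pow_one] at this
      rw [norm_mul, this, mul_one, Complex.norm_real, Real.norm_eq_abs]
    · rw [norm_mul, norm_exp_pow, mul_one, ← Real.norm_eq_abs, ← Complex.norm_real]
      push_cast
      rfl
  have hlow := two_mul_div_pi_le_norm ht.le ht'
  have hsq : (2 * t / π) ^ 2 ≤ ‖z - 1‖ ^ 2 := by gcongr
  have h1 := (mul_le_mul_of_nonneg_right hsq
    (norm_nonneg (∑ k ∈ Finset.range N, (c k : ℂ) * z ^ k))).trans hnorm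
  rw [← div_eq_mul_inv, le_div_iff₀ (by positivity)]
  calc _ = π ^ 2 / 4 * ((2 * t / π) ^ 2 * ‖∑ k ∈ Finset.range N, (c k : ℂ) * z ^ k‖) := by
        field_simp; ring
    _ ≤ _ := by gcongr

lemma integral_norm_geom_le {n m : ℕ} (hn : 1 ≤ n) (hm : n ≤ m) :
    ∫ t in (0 : ℝ)..(1 / n), ‖∑ j ∈ Finset.Ico n m, Complex.exp (Complex.I * t) ^ j‖ ≤
      1 + π * Real.log (m / n) := by
  have hpi := Real.pi_gt_three
  have hn' : (1 : ℝ) ≤ n := by exact_mod_cast hn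
  have hm' : (n : ℝ) ≤ m := by exact_mod_cast hm
  have hinv : (1 : ℝ) / m ≤ 1 / n := by gcongr
  have hinv1 : (1 : ℝ) / n ≤ 1 := by rw [div_le_one (by linarith)]; exact hn'
  have hm0 : (0 : ℝ) < 1 / m := one_div_pos.2 (by linarith)
  have hintble : ∀ a b : ℝ, IntervalIntegrable
      (fun t : ℝ => ‖∑ j ∈ Finset.Ico n m, Complex.exp (Complex.I * t) ^ j‖) volume a b :=
    fun a b => Continuous.intervalIntegrable (by fun_prop) a b
  rw [← intervalIntegral.integral_add_adjacent_intervals (hintble 0 (1 / m)) (hintble _ _)]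
  refine add_le_add ?_ ?_
  · calc _ ≤ ∫ t in (0 : ℝ)..(1 / m), (m : ℝ) := by
          refine intervalIntegral.integral_mono_on hm0.le (hintble _ _) (by simp) fun t _ => ?_
          refine (norm_sum_le _ _).trans ?_
          simp only [norm_exp_pow, Finset.sum_const, Nat.card_Ico, nsmul_eq_mul, mul_one]
          exact_mod_cast Nat.sub_le _ _
      _ = 1 := by
          have : (m : ℝ) ≠ 0 := by linarith
          simp [this]
  · have hz : (0 : ℝ) ∉ uIcc (1 / (m : ℝ)) (1 / n) := by
      rw [uIcc_of_le hinv]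
      exact fun h => absurd h.1 (not_le.2 hm0)
    have hii : IntervalIntegrable (fun t : ℝ => π * t⁻¹) volume (1 / m) (1 / n) :=
      (intervalIntegrable_inv_iff.2 (Or.inr hz)).const_mul π
    calc _ ≤ ∫ t in (1 / (m : ℝ))..(1 / n), π * t⁻¹ := by
          refine intervalIntegral.integral_mono_on hinv (hintble _ _) hii fun t ht => ?_
          have ht0 : 0 < t := hm0.trans_le ht.1
          have hlow := two_mul_div_pi_le_norm ht0.le (by linarith [ht.2])
          set z := Complex.exp (Complex.I * t) with hz
          have hg : (∑ j ∈ Finset.Ico n m, z ^ j) * (z - 1) = z ^ m - z ^ n :=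
            geom_sum_Ico_mul z hm
          have h2 : ‖∑ j ∈ Finset.Ico n m, z ^ j‖ * ‖z - 1‖ ≤ 2 := by
            rw [← norm_mul, hg]
            refine (norm_sub_le _ _).trans ?_
            rw [norm_exp_pow, norm_exp_pow]; norm_num
          have h3 := (mul_le_mul_of_nonneg_left hlow
            (norm_nonneg (∑ j ∈ Finset.Ico n m, z ^ j))).trans h2
          rw [← div_eq_mul_inv, le_div_iff₀ ht0]
          have h4 := mul_le_mul_of_nonneg_left h3 (by positivity : 0 ≤ π / 2)
          calc _ = π / 2 * (‖∑ j ∈ Finset.Ico n m, z ^ j‖ * (2 * t / π)) := by field_simp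
            _ ≤ _ := h4
            _ = π := by ring
      _ = π * Real.log (m / n) := by
          rw [intervalIntegral.integral_const_mul, integral_inv hz]
          congr 2
          field_simp

lemma integral_norm_tail_le {c : ℕ → ℝ} {n N : ℕ} (hn : 1 ≤ n) (hnN : n ≤ N)
    (hN : c N = 0) (hpos : ∀ k, n ≤ k → 0 ≤ c k) (hanti : ∀ k, n ≤ k → c (k + 1) ≤ c k) :
    ∫ t in (0 : ℝ)..(1 / n),
        ‖∑ k ∈ Finset.Ico n N, (c k : ℂ) * Complex.exp (Complex.I * t) ^ k‖ ≤
      c n + π * ∑ k ∈ Finset.Ico n N, c k / k := by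
  have hn' : (1 : ℝ) ≤ n := by exact_mod_cast hn
  have hab : ∀ t : ℝ, ‖∑ k ∈ Finset.Ico n N, (c k : ℂ) * Complex.exp (Complex.I * t) ^ k‖ ≤
      ∑ k ∈ Finset.Ico n N, (c k - c (k + 1)) *
        ‖∑ j ∈ Finset.Ico n (k + 1), Complex.exp (Complex.I * t) ^ j‖ := by
    intro t
    have h := sum_Ico_by_parts' (fun k => (c k : ℂ))
      (fun m => ∑ j ∈ Finset.Ico n m, Complex.exp (Complex.I * t) ^ j) hnN
    simp only [hN, Complex.ofReal_zero, zero_mul, add_zero, Finset.Ico_self, Finset.sum_empty,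
      mul_zero, zero_add] at h
    have h' : ∑ k ∈ Finset.Ico n N, (c k : ℂ) * Complex.exp (Complex.I * t) ^ k =
        ∑ k ∈ Finset.Ico n N, ((c k : ℂ) - c (k + 1)) *
          ∑ j ∈ Finset.Ico n (k + 1), Complex.exp (Complex.I * t) ^ j := by
      rw [h]
      refine Finset.sum_congr rfl fun k hk => ?_
      rw [Finset.sum_Ico_succ_top (Finset.mem_Ico.1 hk).1, add_sub_cancel_left]
    rw [h']
    refine (norm_sum_le _ _).trans (Finset.sum_le_sum fun k hk => ?_)
    rw [norm_mul, ← Complex.ofReal_sub, Complex.norm_real, Real.norm_of_nonneg]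
    linarith [hanti k (Finset.mem_Ico.1 hk).1]
  have hparts := sum_Ico_by_parts' c (fun k : ℕ => 1 + π * Real.log (k / n)) hnN
  simp only [hN, zero_mul, add_zero] at hparts
  calc _ ≤ ∫ t in (0 : ℝ)..(1 / n), ∑ k ∈ Finset.Ico n N, (c k - c (k + 1)) *
        ‖∑ j ∈ Finset.Ico n (k + 1), Complex.exp (Complex.I * t) ^ j‖ := by
        refine intervalIntegral.integral_mono_on (by positivity)
          (Continuous.intervalIntegrable (by fun_prop) _ _)
          (Continuous.intervalIntegrable (by fun_prop) _ _) fun t _ => hab t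
    _ = ∑ k ∈ Finset.Ico n N, (c k - c (k + 1)) * ∫ t in (0 : ℝ)..(1 / n),
        ‖∑ j ∈ Finset.Ico n (k + 1), Complex.exp (Complex.I * t) ^ j‖ := by
        rw [intervalIntegral.integral_finsetSum
          (fun k _ => Continuous.intervalIntegrable (by fun_prop) _ _)]
        simp only [intervalIntegral.integral_const_mul]
    _ ≤ ∑ k ∈ Finset.Ico n N, (c k - c (k + 1)) *
        (1 + π * Real.log ((k + 1 : ℕ) / n)) := by
        refine Finset.sum_le_sum fun k hk => ?_
        have hk' := (Finset.mem_Ico.1 hk).1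
        exact mul_le_mul_of_nonneg_left (integral_norm_geom_le hn (by omega))
          (by linarith [hanti k hk'])
    _ = c n + ∑ k ∈ Finset.Ico n N, c k *
        (1 + π * Real.log ((k + 1 : ℕ) / n) - (1 + π * Real.log (k / n))) := by
        rw [hparts, div_self (by linarith)]; simp
    _ ≤ c n + ∑ k ∈ Finset.Ico n N, π * (c k / k) := by
        refine add_le_add le_rfl (Finset.sum_le_sum fun k hk => ?_)
        have hk' := (Finset.mem_Ico.1 hk).1
        have hk0 : (0 : ℝ) < k := by exact_mod_cast (by omega : 0 < k)
        have hlog : Real.log ((k + 1 : ℕ) / n) - Real.log (k / n) ≤ 1 / k := by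
          rw [← Real.log_div (by positivity) (by positivity)]
          refine (Real.log_le_sub_one_of_pos (by positivity)).trans (le_of_eq ?_)
          push_cast
          field_simp
          ring
        calc _ = c k * (π * (Real.log ((k + 1 : ℕ) / n) - Real.log (k / n))) := by ring
          _ ≤ c k * (π * (1 / k)) := by
            have := hpos k hk'
            have := Real.pi_pos
            gcongr
          _ = _ := by ring
    _ = _ := by rw [← Finset.mul_sum]

lemma integral_norm_le {c : ℕ → ℝ} {n N : ℕ} {D : ℝ} (hn : 1 ≤ n) (hnN : n ≤ N)
    (h0 : c 0 = 0) (hN : c N = 0) (hN1 : c (N + 1) = 0)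
    (hpos : ∀ k, 0 ≤ c k) (hanti : ∀ k, n ≤ k → c (k + 1) ≤ c k)
    (hbound : ∀ k, k ≤ n → c k ≤ D) (hsum : ∑ k ∈ Finset.Ico n N, c k / k ≤ D)
    (hvar : n * (|c 1| + ∑ k ∈ Finset.range N, |c (k + 2) - 2 * c (k + 1) + c k|) ≤ D) :
    ∫ t in (0 : ℝ)..π, ‖∑ k ∈ Finset.range N, (c k : ℂ) * Complex.exp (Complex.I * t) ^ k‖ ≤
      (2 + π + π ^ 2 / 4) * D := by
  have hpi := Real.pi_gt_three
  have hn' : (1 : ℝ) ≤ n := by exact_mod_cast hn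
  have hn0 : (0 : ℝ) < 1 / n := by positivity
  have hn1 : (1 : ℝ) / n ≤ π := by
    have : (1 : ℝ) / n ≤ 1 := by rw [div_le_one (by linarith)]; exact hn'
    linarith
  have hintble : ∀ a b : ℝ, IntervalIntegrable (fun t : ℝ =>
      ‖∑ k ∈ Finset.range N, (c k : ℂ) * Complex.exp (Complex.I * t) ^ k‖) volume a b :=
    fun a b => Continuous.intervalIntegrable (by fun_prop) a b
  rw [← intervalIntegral.integral_add_adjacent_intervals (hintble 0 (1 / n)) (hintble _ _)]
  have hsmall : ∫ t in (0 : ℝ)..(1 / n),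
      ‖∑ k ∈ Finset.range N, (c k : ℂ) * Complex.exp (Complex.I * t) ^ k‖ ≤ D + (D + π * D) := by
    calc _ ≤ ∫ t in (0 : ℝ)..(1 / n), (n * D +
          ‖∑ k ∈ Finset.Ico n N, (c k : ℂ) * Complex.exp (Complex.I * t) ^ k‖) := by
          refine intervalIntegral.integral_mono_on hn0.le (hintble _ _)
            (Continuous.intervalIntegrable (by fun_prop) _ _) fun t _ => ?_
          rw [← Finset.sum_range_add_sum_Ico _ hnN]
          refine (norm_add_le _ _).trans (add_le_add_left ((norm_sum_le _ _).trans ?_) _)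
          calc _ ≤ ∑ k ∈ Finset.range n, D := by
                refine Finset.sum_le_sum fun k hk => ?_
                rw [norm_mul, norm_exp_pow, mul_one, Complex.norm_real,
                  Real.norm_of_nonneg (hpos k)]
                exact hbound k (Finset.mem_range.1 hk).le
            _ = n * D := by simp
      _ = D + ∫ t in (0 : ℝ)..(1 / n),
          ‖∑ k ∈ Finset.Ico n N, (c k : ℂ) * Complex.exp (Complex.I * t) ^ k‖ := by
          rw [intervalIntegral.integral_add (by simp)
            (Continuous.intervalIntegrable (by fun_prop) _ _), intervalIntegral.integral_const]
          congr 1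
          simp only [smul_eq_mul, sub_zero]
          field_simp
      _ ≤ D + (D + π * D) := by
          have := integral_norm_tail_le hn hnN hN (fun k _ => hpos k) hanti
          have h1 := hbound n le_rfl
          have h2 := mul_le_mul_of_nonneg_left hsum (by linarith : 0 ≤ π)
          linarith
  have hlarge : ∫ t in (1 / (n : ℝ))..π,
      ‖∑ k ∈ Finset.range N, (c k : ℂ) * Complex.exp (Complex.I * t) ^ k‖ ≤ π ^ 2 / 4 * D := by
    set V := |c 1| + ∑ k ∈ Finset.range N, |c (k + 2) - 2 * c (k + 1) + c k| with hV
    have hV0 : 0 ≤ V := by positivity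
    have hne : ∀ t ∈ uIcc (1 / (n : ℝ)) π, t ≠ 0 := by
      intro t ht
      rw [uIcc_of_le hn1] at ht
      exact (hn0.trans_le ht.1).ne'
    have hcont : ContinuousOn (fun t : ℝ => (t ^ 2)⁻¹) (uIcc (1 / (n : ℝ)) π) :=
      ContinuousOn.inv₀ (by fun_prop) fun t ht => pow_ne_zero 2 (hne t ht)
    have hint2 : ∫ t in (1 / (n : ℝ))..π, (t ^ 2)⁻¹ = n - π⁻¹ := by
      rw [intervalIntegral.integral_eq_sub_of_hasDerivAt (f := fun t => -t⁻¹)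
        (fun t ht => (neg_neg (t ^ 2)⁻¹) ▸ (hasDerivAt_inv (hne t ht)).neg)
        hcont.intervalIntegrable]
      simp
      ring
    calc _ ≤ ∫ t in (1 / (n : ℝ))..π, π ^ 2 / 4 * V * (t ^ 2)⁻¹ := by
          refine intervalIntegral.integral_mono_on hn1 (hintble _ _)
            (hcont.intervalIntegrable.const_mul _) fun t ht => ?_
          exact norm_sum_le_of_second_difference h0 hN hN1 (hn0.trans_le ht.1) ht.2
      _ = π ^ 2 / 4 * V * (n - π⁻¹) := by rw [intervalIntegral.integral_const_mul, hint2]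
      _ ≤ π ^ 2 / 4 * V * n := by
          have : 0 < π⁻¹ := by positivity
          gcongr
          linarith
      _ = π ^ 2 / 4 * (n * V) := by ring
      _ ≤ π ^ 2 / 4 * D := by gcongr
  linarith

/-! ### The multipliers of the deviation of the Zygmund sums -/

/-- Multipliers (relative to the `(ψ,β)`-derivative) of the Fejér mean of order `N` of the
deviation of the Zygmund sum of order `n`. -/
def deviationMultiplier (ψ : ℝ → ℝ) (n N k : ℕ) : ℝ :=
  max 0 (1 - (k : ℝ) / N) * (if k < n then ψ n * k / n else ψ k)

lemma two_mul_max_zero_le (a b : ℝ) : 2 * max 0 a ≤ max 0 (a + b) + max 0 (a - b) := by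
  rcases le_total 0 a with h | h
  · rw [max_eq_right h]
    linarith [le_max_right 0 (a + b), le_max_right 0 (a - b)]
  · rw [max_eq_left h]
    linarith [le_max_left 0 (a + b), le_max_left 0 (a - b)]

lemma two_mul_mul_le_of_convex {a₀ a₁ a₂ b₀ b₁ b₂ : ℝ} (ha₁ : 0 ≤ a₁) (hb₁ : 0 ≤ b₁)
    (ha : 2 * a₁ ≤ a₀ + a₂) (hb : 2 * b₁ ≤ b₀ + b₂) (haa : a₂ ≤ a₀) (hbb : b₂ ≤ b₀) :
    2 * (a₁ * b₁) ≤ a₀ * b₀ + a₂ * b₂ := by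
  have h1 : (2 * a₁) * (2 * b₁) ≤ (a₀ + a₂) * (b₀ + b₂) :=
    mul_le_mul ha hb (by linarith) (by linarith)
  nlinarith [mul_nonneg (sub_nonneg.2 haa) (sub_nonneg.2 hbb)]

lemma deviationMultiplier_of_le {ψ : ℝ → ℝ} {n N k : ℕ} (hn : 1 ≤ n) (hN : n ≤ N) (hk : k ≤ n) :
    deviationMultiplier ψ n N k = (1 - (k : ℝ) / N) * (ψ n * k / n) := by
  have hn' : (0 : ℝ) < n := by exact_mod_cast hn
  have h1 : (k : ℝ) / N ≤ 1 :=
    div_le_one_of_le₀ (by exact_mod_cast hk.trans hN) (by positivity)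
  unfold deviationMultiplier
  rw [max_eq_right (by linarith)]
  split_ifs with h
  · rfl
  · obtain rfl : k = n := by omega
    congr 1
    field_simp

lemma deviationMultiplier_of_ge {ψ : ℝ → ℝ} {n N k : ℕ} (hk : n ≤ k) :
    deviationMultiplier ψ n N k = max 0 (1 - (k : ℝ) / N) * ψ k := by
  unfold deviationMultiplier
  rw [if_neg (by omega)]

lemma deviationMultiplier_eq_zero {ψ : ℝ → ℝ} {n N k : ℕ} (hN : 1 ≤ N) (hk : N ≤ k) :
    deviationMultiplier ψ n N k = 0 := by
  have hN' : (0 : ℝ) < N := by exact_mod_cast hN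
  have : 1 ≤ (k : ℝ) / N := by
    rw [le_div_iff₀ hN', one_mul]; exact_mod_cast hk
  unfold deviationMultiplier
  rw [max_eq_left (by linarith), zero_mul]

lemma MClass.deviationMultiplier_nonneg {ψ : ℝ → ℝ} (h : MClass ψ) {n : ℕ} (hn : 1 ≤ n)
    (N k : ℕ) : 0 ≤ deviationMultiplier ψ n N k := by
  refine mul_nonneg (le_max_left _ _) ?_
  have := h.1 n (by exact_mod_cast hn)
  split_ifs with hk
  · positivity
  · exact (h.1 k (by exact_mod_cast (by omega : 1 ≤ k))).le

lemma MClass.deviationMultiplier_le {ψ : ℝ → ℝ} (h : MClass ψ) {n : ℕ} (hn : 1 ≤ n)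
    (N : ℕ) {k : ℕ} (hk : n ≤ k) : deviationMultiplier ψ n N k ≤ ψ k := by
  rw [deviationMultiplier_of_ge hk]
  have := h.1 k (by exact_mod_cast hn.trans hk)
  have h1 : max 0 (1 - (k : ℝ) / N) ≤ 1 :=
    max_le zero_le_one (sub_le_self _ (by positivity))
  nlinarith

lemma MClass.deviationMultiplier_succ_le {ψ : ℝ → ℝ} (h : MClass ψ) {n : ℕ} (hn : 1 ≤ n)
    (N : ℕ) {k : ℕ} (hk : n ≤ k) :
    deviationMultiplier ψ n N (k + 1) ≤ deviationMultiplier ψ n N k := by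
  have hk1 : (1 : ℝ) ≤ k := by exact_mod_cast hn.trans hk
  rw [deviationMultiplier_of_ge hk, deviationMultiplier_of_ge (by omega)]
  have hψ := h.1 (k + 1 : ℕ) (by push_cast; linarith)
  refine mul_le_mul ?_ (h.le_of_le hk1 (by push_cast; linarith)) hψ.le (le_max_left _ _)
  gcongr
  simp

lemma MClass.deviationMultiplier_convex {ψ : ℝ → ℝ} (h : MClass ψ) {n : ℕ} (hn : 1 ≤ n)
    (N : ℕ) {k : ℕ} (hk : n ≤ k) :
    0 ≤ deviationMultiplier ψ n N (k + 2) - 2 * deviationMultiplier ψ n N (k + 1) +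
      deviationMultiplier ψ n N k := by
  have hk1 : (1 : ℝ) ≤ k := by exact_mod_cast hn.trans hk
  rw [deviationMultiplier_of_ge hk, deviationMultiplier_of_ge (by omega : n ≤ k + 1),
    deviationMultiplier_of_ge (by omega : n ≤ k + 2)]
  have hψ := h.1 (k + 1 : ℕ) (by push_cast; linarith)
  have hanti := h.le_of_le (x := k) (y := (k + 2 : ℕ)) hk1 (by push_cast; linarith)
  have hconv := h.2.1.secant_mono_aux1 (x := (k : ℝ)) (y := (k + 1 : ℕ)) (z := (k + 2 : ℕ))
    (mem_Ici.2 hk1) (mem_Ici.2 (by push_cast; linarith)) (by simp) (by simp)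
  have hw : 2 * max 0 (1 - ((k + 1 : ℕ) : ℝ) / N) ≤
      max 0 (1 - (k : ℝ) / N) + max 0 (1 - ((k + 2 : ℕ) : ℝ) / N) := by
    have e₀ : 1 - (k : ℝ) / N = (1 - ((k + 1 : ℕ) : ℝ) / N) + 1 / N := by push_cast; ring
    have e₂ : 1 - ((k + 2 : ℕ) : ℝ) / N = (1 - ((k + 1 : ℕ) : ℝ) / N) - 1 / N := by
      push_cast; ring
    rw [e₀, e₂]
    exact two_mul_max_zero_le _ _
  have hwanti : max 0 (1 - ((k + 2 : ℕ) : ℝ) / N) ≤ max 0 (1 - (k : ℝ) / N) := by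
    gcongr
    simp
  have := two_mul_mul_le_of_convex (le_max_left _ _) hψ.le hw
    (b₀ := ψ k) (b₂ := ψ (k + 2 : ℕ)) (by push_cast at hconv ⊢; linarith) hwanti hanti
  linarith

lemma MClass.mul_deviationMultiplier_sub_le {ψ : ℝ → ℝ} (h : MClass ψ) {A : ℝ}
    (hA : ∀ x ≥ (1 : ℝ), x * (ψ x - ψ (x + 1)) ≤ A * ψ x) {n N : ℕ} (hn : 1 ≤ n)
    (hN : n + 1 ≤ N) :
    n * (deviationMultiplier ψ n N n - deviationMultiplier ψ n N (n + 1)) ≤ (A + 1) * ψ n := by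
  have hn' : (1 : ℝ) ≤ n := by exact_mod_cast hn
  have hN' : (n : ℝ) + 1 ≤ N := by exact_mod_cast hN
  have hN0 : (0 : ℝ) < N := by linarith
  have h1 : (n : ℝ) / N ≤ 1 := by rw [div_le_one hN0]; linarith
  have h2 : ((n : ℝ) + 1) / N ≤ 1 := by rwa [div_le_one hN0]
  have h0 : 0 ≤ ((n : ℝ) + 1) / N := by positivity
  have hψ := h.1 n hn'
  have hanti := h.le_of_le hn' (by linarith : (n : ℝ) ≤ n + 1)
  rw [deviationMultiplier_of_ge le_rfl, deviationMultiplier_of_ge (by omega)]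
  push_cast
  rw [max_eq_right (by linarith), max_eq_right (by linarith)]
  have e : n * ((1 - (n : ℝ) / N) * ψ n - (1 - ((n : ℝ) + 1) / N) * ψ (n + 1)) =
      (1 - ((n : ℝ) + 1) / N) * (n * (ψ n - ψ (n + 1))) + n / N * ψ n := by
    field_simp; ring
  rw [e]
  have h3 : 0 ≤ n * (ψ n - ψ (n + 1)) := mul_nonneg (by linarith) (by linarith)
  have h4 := hA n hn'
  nlinarith

lemma MClass.deviationMultiplier_variation_le {ψ : ℝ → ℝ} (h : MClass ψ) {A : ℝ}
    (hA : ∀ x ≥ (1 : ℝ), x * (ψ x - ψ (x + 1)) ≤ A * ψ x) {n N : ℕ} (hn : 1 ≤ n)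
    (hN : 2 * n ≤ N) :
    n * (|deviationMultiplier ψ n N 1| + ∑ k ∈ Finset.range N,
      |deviationMultiplier ψ n N (k + 2) - 2 * deviationMultiplier ψ n N (k + 1) +
        deviationMultiplier ψ n N k|) ≤ (2 * A + 5) * ψ n := by
  set c := deviationMultiplier ψ n N with hc
  obtain ⟨p, rfl⟩ : ∃ p, n = p + 1 := ⟨n - 1, by omega⟩
  have hn' : (1 : ℝ) ≤ (p + 1 : ℕ) := by exact_mod_cast hn
  have hN' : 2 * ((p + 1 : ℕ) : ℝ) ≤ N := by exact_mod_cast hN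
  have hN0 : (0 : ℝ) < N := by linarith
  have hp : ((p + 1 : ℕ) : ℝ) = p + 1 := by push_cast; rfl
  have hψ := h.1 (p + 1 : ℕ) hn'
  have hhead : ∀ k ≤ p + 1, c k = (1 - (k : ℝ) / N) * (ψ (p + 1 : ℕ) * k / (p + 1 : ℕ)) :=
    fun k hk => deviationMultiplier_of_le hn (by omega) hk
  have hcorner := h.mul_deviationMultiplier_sub_le hA hn (by omega : p + 1 + 1 ≤ N)
  have hfirst : ((p + 1 : ℕ) : ℝ) * |c 1| ≤ ψ (p + 1 : ℕ) := by
    have h1 : 0 ≤ c 1 := h.deviationMultiplier_nonneg hn N 1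
    rw [abs_of_nonneg h1, hhead 1 (by omega)]
    have e : ((p + 1 : ℕ) : ℝ) * ((1 - ((1 : ℕ) : ℝ) / N) *
        (ψ (p + 1 : ℕ) * (1 : ℕ) / (p + 1 : ℕ))) = (1 - 1 / N) * ψ (p + 1 : ℕ) := by
      rw [Nat.cast_one]
      field_simp
    rw [e]
    have : 0 < 1 / (N : ℝ) := by positivity
    nlinarith
  have hlow : ((p + 1 : ℕ) : ℝ) * ∑ k ∈ Finset.range p, |c (k + 2) - 2 * c (k + 1) + c k| ≤
      ψ (p + 1 : ℕ) := by
    have : ∀ k ∈ Finset.range p, |c (k + 2) - 2 * c (k + 1) + c k| =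
        2 * ψ (p + 1 : ℕ) / ((p + 1 : ℕ) * N) := by
      intro k hk
      have hk := Finset.mem_range.1 hk
      have e : c (k + 2) - 2 * c (k + 1) + c k = -(2 * ψ (p + 1 : ℕ) / ((p + 1 : ℕ) * N)) := by
        rw [hhead _ (by omega), hhead _ (by omega), hhead _ (by omega)]
        have : ((p + 1 : ℕ) : ℝ) ≠ 0 := by linarith
        push_cast [Nat.cast_add k]
        field_simp
        ring
      rw [e, abs_neg, abs_of_nonneg (by positivity)]
    rw [Finset.sum_congr rfl this, Finset.sum_const, Finset.card_range, nsmul_eq_mul]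
    have e : ((p + 1 : ℕ) : ℝ) * (p * (2 * ψ (p + 1 : ℕ) / ((p + 1 : ℕ) * N))) =
        ψ (p + 1 : ℕ) * (2 * p / N) := by
      field_simp
    rw [e]
    have : 2 * (p : ℝ) / N ≤ 1 := by rw [div_le_one hN0]; linarith
    nlinarith
  have hmid : ((p + 1 : ℕ) : ℝ) * |c (p + 2) - 2 * c (p + 1) + c p| ≤
      (A + 2) * ψ (p + 1 : ℕ) := by
    have h1 : c (p + 1 + 1) ≤ c (p + 1) := h.deviationMultiplier_succ_le hn N le_rfl
    have h2 : ((p + 1 : ℕ) : ℝ) * (c (p + 1) - c p) = (1 - (2 * p + 1) / N) * ψ (p + 1 : ℕ) := by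
      rw [hhead _ (by omega), hhead _ (by omega), hp]
      field_simp
      ring
    have h3 : 0 ≤ (2 * (p : ℝ) + 1) / N := by positivity
    have h4 : (2 * (p : ℝ) + 1) / N ≤ 1 := by rw [div_le_one hN0]; linarith
    have h5 : 0 ≤ c (p + 1) - c p := by
      by_contra! hneg
      nlinarith
    have h6 : |c (p + 2) - 2 * c (p + 1) + c p| ≤
        (c (p + 1) - c (p + 1 + 1)) + (c (p + 1) - c p) := by
      rw [abs_le]; constructor <;> linarith
    have h7 := mul_le_mul_of_nonneg_left h6 (by linarith : (0 : ℝ) ≤ (p + 1 : ℕ))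
    nlinarith
  have htail : ∑ k ∈ Finset.Ico (p + 1) N, |c (k + 2) - 2 * c (k + 1) + c k| =
      c (p + 1) - c (p + 1 + 1) := by
    have h1 : ∀ k ∈ Finset.Ico (p + 1) N, |c (k + 2) - 2 * c (k + 1) + c k| =
        (c k - c (k + 1)) - (c (k + 1) - c (k + 1 + 1)) := by
      intro k hk
      rw [abs_of_nonneg (h.deviationMultiplier_convex hn N (Finset.mem_Ico.1 hk).1)]
      ring
    rw [Finset.sum_congr rfl h1, sum_Ico_sub_succ (fun k => c k - c (k + 1)) (by omega),
      hc, deviationMultiplier_eq_zero (k := N) (by omega) le_rfl,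
      deviationMultiplier_eq_zero (k := N + 1) (by omega) (by omega)]
    ring
  rw [← Finset.sum_range_add_sum_Ico _ (by omega : p + 1 ≤ N), Finset.sum_range_succ, htail]
  linarith

lemma MCClass.exists_integral_norm_le {ψ : ℝ → ℝ} (h : MCClass ψ) :
    ∃ C > (0 : ℝ), ∀ n N : ℕ, 1 ≤ n → 2 * n ≤ N →
      ∫ t in (0 : ℝ)..π, ‖∑ k ∈ Finset.range N,
        (deviationMultiplier ψ n N k : ℂ) * Complex.exp (Complex.I * t) ^ k‖ ≤ C * ψ n := by
  obtain ⟨A, hA, hA'⟩ := h.exists_mul_sub_le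
  obtain ⟨B, hB, hB'⟩ := h.exists_sum_div_le
  refine ⟨(2 + π + π ^ 2 / 4) * (2 * A + 5 + B), by positivity, fun n N hn hN => ?_⟩
  have hn' : (1 : ℝ) ≤ n := by exact_mod_cast hn
  have hψ := h.1.1 n hn'
  have hAψ : 0 < A * ψ n := by positivity
  have hBψ : 0 < B * ψ n := by positivity
  rw [mul_assoc]
  refine integral_norm_le hn (by omega) ?_ (deviationMultiplier_eq_zero (by omega) le_rfl)
    (deviationMultiplier_eq_zero (by omega) (by omega)) (h.1.deviationMultiplier_nonneg hn N)
    (fun k hk => h.1.deviationMultiplier_succ_le hn N hk) (fun k hk => ?_) ?_ ?_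
  · rw [deviationMultiplier_of_le hn (by omega) (by omega)]; simp
  · have h1 : (k : ℝ) / n ≤ 1 := div_le_one_of_le₀ (by exact_mod_cast hk) (by positivity)
    have h2 : 0 ≤ (k : ℝ) / N := by positivity
    have h3 : 0 ≤ (k : ℝ) / n := by positivity
    rw [deviationMultiplier_of_le hn (by omega) hk, mul_div_assoc]
    have h4 : ψ n * (k / n) ≤ ψ n := by nlinarith
    have h5 : 0 ≤ ψ n * (k / n) := by positivity
    nlinarith
  · refine (Finset.sum_le_sum fun k hk => ?_).trans ((hB' n N hn).trans (by linarith))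
    gcongr
    exact h.1.deviationMultiplier_le hn N (Finset.mem_Ico.1 hk).1
  · refine (h.1.deviationMultiplier_variation_le hA' hn hN).trans ?_
    linarith

/-! ### The deviation as a convolution with the `(ψ,β)`-derivative -/

lemma SInf.intervalIntegrable {g : ℝ → ℝ} (hg : SInf g) (a b : ℝ) :
    IntervalIntegrable g volume a b := by
  refine IntervalIntegrable.mono_fun (intervalIntegrable_const (c := (1 : ℝ)))
    hg.1.aestronglyMeasurable ?_
  filter_upwards [ae_restrict_of_ae hg.2.2] with t ht
  simpa using ht

lemma IsPsiDeriv.harmonicTerm_eq {ψ : ℕ → ℝ} {β : ℝ} {f g : ℝ → ℝ} (h : IsPsiDeriv ψ β f g)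
    {k : ℕ} (hk : 1 ≤ k) (hψ : ψ k ≠ 0) (x : ℝ) :
    harmonicTerm f k x =
      ψ k * ((1 / π) * ∫ t in (-π)..π, g t * Real.cos (k * (x - t) - β * π / 2)) := by
  obtain ⟨hg, -, hcoef⟩ := h
  obtain ⟨ha, hb⟩ := hcoef k hk
  have hintble := hg.intervalIntegrable (-π) π
  have e : ∀ t, g t * Real.cos (k * (x - t) - β * π / 2) =
      g t * Real.cos (k * t) * Real.cos (k * x - β * π / 2) +
        g t * Real.sin (k * t) * Real.sin (k * x - β * π / 2) := by
    intro t
    have : k * (x - t) - β * π / 2 = (k * x - β * π / 2) - k * t := by ring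
    rw [this, Real.cos_sub]; ring
  have hI : (1 / π) * ∫ t in (-π)..π, g t * Real.cos (k * (x - t) - β * π / 2) =
      fourierA g k * Real.cos (k * x - β * π / 2) +
        fourierB g k * Real.sin (k * x - β * π / 2) := by
    simp only [e]
    rw [intervalIntegral.integral_add, intervalIntegral.integral_mul_const,
      intervalIntegral.integral_mul_const, fourierA, fourierB]
    · ring
    · exact (hintble.mul_continuousOn (by fun_prop)).mul_continuousOn (by fun_prop)
    · exact (hintble.mul_continuousOn (by fun_prop)).mul_continuousOn (by fun_prop)
  rw [hI, ha, hb, harmonicTerm, if_neg (by omega), Real.cos_sub, Real.sin_sub]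
  field_simp
  linear_combination (-(fourierA f k * Real.cos (k * x) + fourierB f k * Real.sin (k * x))) *
    Real.sin_sq_add_cos_sq (β * π / 2)

lemma abs_sum_cos_le (c : ℕ → ℝ) (N : ℕ) (s θ : ℝ) :
    |∑ k ∈ Finset.range N, c k * Real.cos (k * s - θ)| ≤
      ‖∑ k ∈ Finset.range N, (c k : ℂ) * Complex.exp (Complex.I * s) ^ k‖ := by
  have h1 : ∑ k ∈ Finset.range N, c k * Real.cos (k * s - θ) =
      (Complex.exp ((-θ : ℝ) * Complex.I) *
        ∑ k ∈ Finset.range N, (c k : ℂ) * Complex.exp (Complex.I * s) ^ k).re := by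
    rw [Finset.mul_sum, Complex.re_sum]
    refine Finset.sum_congr rfl fun k _ => ?_
    have e : Complex.exp ((-θ : ℝ) * Complex.I) *
        ((c k : ℂ) * Complex.exp (Complex.I * s) ^ k) =
        (c k : ℂ) * Complex.exp ((k * s - θ : ℝ) * Complex.I) := by
      rw [← Complex.exp_nat_mul, mul_left_comm, ← Complex.exp_add]
      congr 2
      push_cast
      ring
    rw [e, Complex.re_ofReal_mul, Complex.exp_ofReal_mul_I_re]
  rw [h1]
  refine (Complex.abs_re_le_norm _).trans ?_
  rw [norm_mul, Complex.norm_exp_ofReal_mul_I, one_mul]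

lemma integral_norm_comp_sub (c : ℕ → ℝ) (N : ℕ) (x : ℝ) :
    ∫ t in (-π)..π, ‖∑ k ∈ Finset.range N,
        (c k : ℂ) * Complex.exp (Complex.I * (x - t : ℝ)) ^ k‖ =
      2 * ∫ t in (0 : ℝ)..π,
        ‖∑ k ∈ Finset.range N, (c k : ℂ) * Complex.exp (Complex.I * t) ^ k‖ := by
  set F : ℝ → ℝ := fun t =>
    ‖∑ k ∈ Finset.range N, (c k : ℂ) * Complex.exp (Complex.I * t) ^ k‖ with hF
  have hcont : Continuous F := by fun_prop
  have hper : Function.Periodic F (2 * π) := by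
    intro t
    have : Complex.exp (Complex.I * (t + 2 * π : ℝ)) = Complex.exp (Complex.I * t) := by
      have e : Complex.I * (t + 2 * π : ℝ) = Complex.I * t + 2 * π * Complex.I := by
        push_cast; ring
      rw [e, Complex.exp_add, Complex.exp_two_pi_mul_I, mul_one]
    simp only [hF, this]
  have heven : ∀ t, F (-t) = F t := by
    intro t
    have : ∑ k ∈ Finset.range N, (c k : ℂ) * Complex.exp (Complex.I * (-t : ℝ)) ^ k =
        (starRingEnd ℂ) (∑ k ∈ Finset.range N,
          (c k : ℂ) * Complex.exp (Complex.I * t) ^ k) := by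
      rw [map_sum]
      refine Finset.sum_congr rfl fun k _ => ?_
      rw [map_mul, map_pow, Complex.conj_ofReal, ← Complex.exp_conj, map_mul, Complex.conj_I,
        Complex.conj_ofReal]
      push_cast
      ring_nf
    simp only [hF]
    rw [this, Complex.norm_conj]
  have h1 : ∫ t in (-π)..π, F (x - t) = ∫ t in (-π)..π, F t := by
    rw [intervalIntegral.integral_comp_sub_left]
    convert hper.intervalIntegral_add_eq (x - π) (-π) using 2 <;> ring
  have h2 : ∫ t in (-π)..0, F t = ∫ t in (0 : ℝ)..π, F t := by
    have := intervalIntegral.integral_comp_neg F (a := 0) (b := π)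
    rw [neg_zero] at this
    rw [← this]
    simp only [heven]
  change ∫ t in (-π)..π, F (x - t) = _
  rw [h1, ← intervalIntegral.integral_add_adjacent_intervals
    (hcont.intervalIntegrable (-π) 0) (hcont.intervalIntegrable 0 π), h2]
  ring

lemma abs_integral_mul_sum_cos_le {g : ℝ → ℝ} (hg : SInf g) (c : ℕ → ℝ) (N : ℕ) (x θ : ℝ) :
    |∫ t in (-π)..π, g t * ∑ k ∈ Finset.range N, c k * Real.cos (k * (x - t) - θ)| ≤
      2 * ∫ t in (0 : ℝ)..π,
        ‖∑ k ∈ Finset.range N, (c k : ℂ) * Complex.exp (Complex.I * t) ^ k‖ := by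
  rw [← integral_norm_comp_sub c N x, ← Real.norm_eq_abs]
  refine intervalIntegral.norm_integral_le_of_norm_le (by linarith [Real.pi_pos]) ?_
    (Continuous.intervalIntegrable (by fun_prop) _ _)
  filter_upwards [hg.2.2] with t ht _
  rw [norm_mul, Real.norm_eq_abs, Real.norm_eq_abs]
  refine (mul_le_of_le_one_left (abs_nonneg _) ht).trans (abs_sum_cos_le c N (x - t) θ)

/-- The Fejér means of the deviation of the Zygmund sums. -/
lemma tendsto_fejerMean_deviation {f : ℝ → ℝ} (hf : Continuous f) (hp : Periodic2pi f)
    (φ : ℕ → ℝ) (n : ℕ) (x : ℝ) :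
    Tendsto (fun N : ℕ => ∑ k ∈ Finset.range N, (1 - (k : ℝ) / N) *
        ((if k < n then φ k / φ n else 1) * harmonicTerm f k x))
      atTop (nhds (f x - ZygmundSum φ n f x)) := by
  have h1 : Tendsto (fun N : ℕ => ∑ k ∈ Finset.range n, (1 - (k : ℝ) / N) *
      ((1 - φ k / φ n) * harmonicTerm f k x)) atTop (nhds (ZygmundSum φ n f x)) := by
    unfold ZygmundSum
    refine tendsto_finsetSum _ fun k _ => ?_
    have h := (tendsto_const_div_atTop_nhds_zero_nat (k : ℝ)).const_sub 1
    simpa using h.mul_const ((1 - φ k / φ n) * harmonicTerm f k x)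
  refine ((tendsto_fejerMean hf hp x).sub h1).congr' ?_
  filter_upwards [eventually_ge_atTop n] with N hN
  rw [← Finset.sum_range_add_sum_Ico _ hN, ← Finset.sum_range_add_sum_Ico _ hN,
    add_sub_right_comm, ← Finset.sum_sub_distrib]
  congr 1
  · refine Finset.sum_congr rfl fun k hk => ?_
    rw [if_pos (Finset.mem_range.1 hk)]
    ring
  · refine Finset.sum_congr rfl fun k hk => ?_
    rw [if_neg (by have := (Finset.mem_Ico.1 hk).1; omega), one_mul]

lemma MClass.abs_fejerMean_deviation_le {ψ : ℝ → ℝ} (h : MClass ψ) {β : ℝ} {f g : ℝ → ℝ}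
    (hg : IsPsiDeriv (fun k : ℕ => ψ k) β f g) {n : ℕ} (hn : 1 ≤ n) (N : ℕ) (x : ℝ) :
    |∑ k ∈ Finset.range N, (1 - (k : ℝ) / N) *
        ((if k < n then ((k : ℝ) / ψ k) / ((n : ℝ) / ψ n) else 1) * harmonicTerm f k x)| ≤
      (2 / π) * ∫ t in (0 : ℝ)..π, ‖∑ k ∈ Finset.range N,
        (deviationMultiplier ψ n N k : ℂ) * Complex.exp (Complex.I * t) ^ k‖ := by
  have hpi := Real.pi_pos
  have hintble := hg.1.intervalIntegrable (-π) π
  have hn' : (0 : ℝ) < n := by exact_mod_cast hn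
  have hψn := h.1 n (by exact_mod_cast hn)
  have heq : ∑ k ∈ Finset.range N, (1 - (k : ℝ) / N) *
        ((if k < n then ((k : ℝ) / ψ k) / ((n : ℝ) / ψ n) else 1) * harmonicTerm f k x) =
      (1 / π) * ∫ t in (-π)..π, g t * ∑ k ∈ Finset.range N,
        deviationMultiplier ψ n N k * Real.cos (k * (x - t) - β * π / 2) := by
    simp only [Finset.mul_sum]
    rw [intervalIntegral.integral_finsetSum
      (fun k _ => hintble.mul_continuousOn (by fun_prop)), Finset.mul_sum]
    refine Finset.sum_congr rfl fun k hk => ?_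
    have e : ∀ t, g t * (deviationMultiplier ψ n N k * Real.cos (k * (x - t) - β * π / 2)) =
        deviationMultiplier ψ n N k * (g t * Real.cos (k * (x - t) - β * π / 2)) :=
      fun t => by ring
    simp only [e]
    rw [intervalIntegral.integral_const_mul]
    rcases Nat.eq_zero_or_pos k with rfl | hk0
    · simp [deviationMultiplier, Nat.pos_of_ne_zero (Nat.ne_zero_of_lt hn)]
    · have hψk := h.1 k (by exact_mod_cast hk0)
      have hw : (k : ℝ) / N ≤ 1 :=
        div_le_one_of_le₀ (by exact_mod_cast (Finset.mem_range.1 hk).le) (by positivity)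
      rw [hg.harmonicTerm_eq hk0 hψk.ne' x, deviationMultiplier, max_eq_right (by linarith)]
      generalize ∫ t in (-π)..π, g t * Real.cos (k * (x - t) - β * π / 2) = J
      split_ifs
      · field_simp
      · ring
  rw [heq, abs_mul, abs_of_pos (by positivity)]
  calc _ ≤ 1 / π * (2 * _) := by
        gcongr
        exact abs_integral_mul_sum_cos_le hg.1 _ N x _
    _ = _ := by ring

/-- for `ψ ∈ M_C` and `φ(k) = k/ψ(k)` there is `C = C(ψ) > 0` with
`E(C^ψ_{β,∞}; Z^φ_n) ≤ C ψ(n)` for all `n` and `β`. -/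
theorem statement4 (ψ : ℝ → ℝ) (hψ : MCClass ψ) :
    ∃ C > (0 : ℝ), ∀ (β : ℝ) (n : ℕ), 1 ≤ n →
      classSup (fun k : ℕ => ψ k) β (ZygmundSum (fun k : ℕ => (k : ℝ) / ψ k) n) ≤ C * ψ n := by
  obtain ⟨C, hC, hbound⟩ := hψ.exists_integral_norm_le
  have hpi := Real.pi_pos
  refine ⟨2 / π * C, by positivity, fun β n hn => ?_⟩
  have hψn := hψ.1.1 n (by exact_mod_cast hn)
  refine Real.sSup_le ?_ (by positivity)
  rintro e ⟨f, ⟨hf, hp, g, hg⟩, rfl⟩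
  refine Real.iSup_le (fun x => ?_) (by positivity)
  refine le_of_tendsto (tendsto_fejerMean_deviation hf hp _ n x).abs ?_
  filter_upwards [eventually_ge_atTop (2 * n)] with N hN
  refine (hψ.1.abs_fejerMean_deviation_le hg hn N x).trans ?_
  rw [mul_assoc]
  gcongr
  exact hbound n N hn hN
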